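/- arXiv:2011.05947 — 7 statements merged into one kernel-verified Lean document; each statement's English description precedes it below -/
import Mathlib

section
/- Define E : ℝ → B(H) by E(t) := −cfc(x ↦ sin(t√x)/√x, A). Then: (i) E(0) = 0; (ii) for every t ∈ ℝ, E is norm-differentiable at t with derivative −C_t, so in particular E′(0) = −Id; (iii) for every t ∈ ℝ, the derivative map t ↦ −C_t is itself norm-differentiable at t with derivative −(A ∘ E(t)), i.e. E″(t) + A ∘ E(t) = 0 for all t; (iv) each E(t) is self-adjoint and E(−t) = −E(t) for all t. -/
/-- Differentiation under the continuous functional calculus: if `t ↦ F t x` has derivative `F' t x`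
for every `x` in the spectrum of `a`, and `F'` is jointly continuous, then `t ↦ cfc (F t) a` is norm
differentiable with derivative `cfc (F' t) a`. -/
theorem hasDerivAt_cfc_fun {𝓐 : Type*} [NormedRing 𝓐] [StarRing 𝓐] [NormedAlgebra ℝ 𝓐]
    {p : 𝓐 → Prop} [IsometricContinuousFunctionalCalculus ℝ 𝓐 p]
    {F F' : ℝ → ℝ → ℝ} {a : 𝓐} (t : ℝ)
    (hF : ∀ s, ContinuousOn (F s) (spectrum ℝ a))
    (hF' : ContinuousOn (Function.uncurry F') (Set.univ ×ˢ spectrum ℝ a))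
    (hderiv : ∀ s, ∀ x ∈ spectrum ℝ a, HasDerivAt (fun u => F u x) (F' s x) s) :
    HasDerivAt (fun s => cfc (F s) a) (cfc (F' t) a) t := by
  have hF_cont : ContinuousOn (F' t) (spectrum ℝ a) :=
    hF'.comp (f := fun x => (t, x)) (by fun_prop) fun x hx => ⟨Set.mem_univ t, hx⟩
  rw [hasDerivAt_iff_isLittleO, Asymptotics.isLittleO_iff]
  intro ε hε
  obtain ⟨v, hv, hvF⟩ := (ContinuousFunctionalCalculus.isCompact_spectrum a).mem_uniformity_of_prod
    hF' (Set.mem_univ t) (Metric.dist_mem_uniformity hε)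
  rw [nhdsWithin_univ] at hv
  obtain ⟨δ, hδ, hball⟩ := Metric.mem_nhds_iff.1 hv
  filter_upwards [Metric.ball_mem_nhds t hδ] with s hs
  rw [← cfc_smul (s - t) (F' t) a, ← cfc_sub (F s) (F t) a, ← cfc_sub _ _ a]
  refine norm_cfc_le (by positivity) fun x hx => ?_
  have hder : ∀ u ∈ Metric.ball t δ,
      HasDerivWithinAt (fun u => F u x - u * F' t x) (F' u x - F' t x) (Metric.ball t δ) u := by
    intro u _
    simpa using ((hderiv u x hx).fun_sub ((hasDerivAt_id u).mul_const (F' t x))).hasDerivWithinAt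
  have hbound : ∀ u ∈ Metric.ball t δ, ‖F' u x - F' t x‖ ≤ ε := by
    intro u hu
    have := hvF u (hball hu) x hx
    rw [← dist_eq_norm]
    exact le_of_lt this
  have hmv := (convex_ball t δ).norm_image_sub_le_of_norm_hasDerivWithin_le hder hbound
    (Metric.mem_ball_self hδ) hs
  have heq : F s x - F t x - (s - t) • F' t x = F s x - s * F' t x - (F t x - t * F' t x) := by
    rw [smul_eq_mul]
    ring
  rw [heq]
  exact hmv

/-- **Causal propagator of the abstract Klein–Gordon operator.**
Let `H` be a nontrivial complex Hilbert space and `A` a bounded self-adjoint operator on `H`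
whose real spectrum is contained in `[c, ∞)` for some `c > 0`.  Define
`E t := -cfc (fun x => sin (t√x)/√x) A`.  Then
(i) `E 0 = 0`;
(ii) `E` is norm-differentiable at each `t` with derivative `-C_t` where
  `C_t = cfc (fun x => cos (t√x)) A`; in particular `E' 0 = -Id`;
(iii) the derivative map `t ↦ -C_t` is norm-differentiable at each `t` with derivative
  `-(A ∘ E t)`, i.e. `E'' t + A ∘ E t = 0`;
(iv) each `E t` is self-adjoint and `E (-t) = -E t`. -/
theorem causal_propagator_properties
    {H : Type*} [NormedAddCommGroup H] [InnerProductSpace ℂ H]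
    [CompleteSpace H] [Nontrivial H]
    (A : H →L[ℂ] H) (hA : IsSelfAdjoint A)
    (c : ℝ) (hc : 0 < c) (hspec : spectrum ℝ A ⊆ Set.Ici c)
    (E : ℝ → H →L[ℂ] H)
    (hE : ∀ t : ℝ, E t =
      -cfc (fun x : ℝ => Real.sin (t * Real.sqrt x) / Real.sqrt x) A) :
    E 0 = 0 ∧
    (∀ t : ℝ, HasDerivAt E
      (-cfc (fun x : ℝ => Real.cos (t * Real.sqrt x)) A) t) ∧
    HasDerivAt E (-(1 : H →L[ℂ] H)) 0 ∧
    (∀ t : ℝ, HasDerivAt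
      (fun s : ℝ => -cfc (fun x : ℝ => Real.cos (s * Real.sqrt x)) A)
      (-(A * E t)) t) ∧
    (∀ t : ℝ, IsSelfAdjoint (E t)) ∧
    (∀ t : ℝ, E (-t) = -E t) := by
  have hne : ∀ x ∈ spectrum ℝ A, √x ≠ 0 :=
    fun x hx => (Real.sqrt_pos.2 (hc.trans_le (hspec hx))).ne'
  have hS : ∀ t : ℝ, ContinuousOn (fun x : ℝ => Real.sin (t * √x) / √x) (spectrum ℝ A) :=
    fun t => ContinuousOn.div (by fun_prop) (by fun_prop) hne
  have hE' : E = fun t => -cfc (fun x : ℝ => Real.sin (t * √x) / √x) A := funext hE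
  have hderivE : ∀ t : ℝ, HasDerivAt E (-cfc (fun x : ℝ => Real.cos (t * √x)) A) t := by
    intro t
    rw [hE']
    refine (hasDerivAt_cfc_fun (F' := fun t x => Real.cos (t * √x)) t hS
      (by unfold Function.uncurry; fun_prop) (fun s x hx => ?_)).fun_neg
    have h := (((hasDerivAt_id s).mul_const √x).sin).div_const √x
    simpa [hne x hx] using h
  refine ⟨?_, hderivE, ?_, fun t => ?_, fun t => ?_, fun t => ?_⟩
  · simp [hE]
  · simpa [cfc_const_one ℝ A] using hderivE 0
  · have hAE : A * E t = cfc (fun x : ℝ => -√x * Real.sin (t * √x)) A := by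
      rw [hE, mul_neg]
      conv_lhs => enter [1, 1]; rw [← cfc_id' ℝ A]
      rw [← cfc_mul _ _ A (by fun_prop) (hS t), ← cfc_neg]
      refine cfc_congr fun x hx => ?_
      have hsq : √x * √x = x := Real.mul_self_sqrt (hc.le.trans (hspec hx))
      have := hne x hx
      field_simp
      linear_combination Real.sin (t * √x) * hsq
    rw [hAE]
    refine (hasDerivAt_cfc_fun (F' := fun t x => -√x * Real.sin (t * √x)) t
      (fun s => by fun_prop) (by unfold Function.uncurry; fun_prop) (fun s x _ => ?_)).fun_neg
    have h := ((hasDerivAt_id' s).mul_const √x).cos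
    convert h using 1
    ring
  · rw [hE]
    exact (cfc_predicate _ A : IsSelfAdjoint _).neg
  · rw [hE, hE, ← cfc_neg]
    simp [neg_div]
end

section
/- For every t ∈ ℝ, the operator-valued map t ↦ C_t = cfc(x ↦ cos(t√x), A) is norm-differentiable at t, with derivative equal to −cfc(x ↦ √x · sin(t√x), A). -/
/-- First-order Taylor estimate for the cosine, with a quadratic remainder. -/
theorem Real.abs_cos_sub_cos_add_mul_sin_le (a b : ℝ) :
    |Real.cos b - Real.cos a + (b - a) * Real.sin a| ≤ |b - a| ^ 2 := by
  have hderiv : ∀ x ∈ Set.uIcc a b, HasDerivWithinAt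
      (fun y => Real.cos y + y * Real.sin a) (-Real.sin x + Real.sin a) (Set.uIcc a b) x := by
    intro x _
    simpa using! ((Real.hasDerivAt_cos x).add
      ((hasDerivAt_id x).mul_const (Real.sin a))).hasDerivWithinAt
  have hbound : ∀ x ∈ Set.uIcc a b, ‖-Real.sin x + Real.sin a‖ ≤ |b - a| := by
    intro x hx
    calc ‖-Real.sin x + Real.sin a‖ = |Real.sin x - Real.sin a| := by
          rw [Real.norm_eq_abs, ← abs_neg]
          ring_nf
      _ ≤ |x - a| := Real.abs_sin_sub_sin_le x a
      _ ≤ |b - a| := Set.abs_sub_left_of_mem_uIcc hx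
  have h := (convex_uIcc a b).norm_image_sub_le_of_norm_hasDerivWithin_le hderiv hbound
    Set.left_mem_uIcc Set.right_mem_uIcc
  rw [Real.norm_eq_abs, Real.norm_eq_abs, ← pow_two] at h
  convert h using 2
  ring

/-- For a bounded self-adjoint operator `A` on a nontrivial complex Hilbert space with
real spectrum contained in `[c, ∞)`, `c > 0`, the map `t ↦ C_t = cfc (fun x => cos (t√x)) A`
is norm-differentiable at every `t`, with derivative `-cfc (fun x => √x · sin (t√x)) A`. -/
theorem cos_cfc_hasDerivAt
    {H : Type*} [NormedAddCommGroup H] [InnerProductSpace ℂ H]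
    [CompleteSpace H] [Nontrivial H]
    (A : H →L[ℂ] H) (hA : IsSelfAdjoint A)
    (c : ℝ) (hc : 0 < c) (hspec : spectrum ℝ A ⊆ Set.Ici c) (t : ℝ) :
    HasDerivAt (fun s : ℝ => cfc (fun x : ℝ => Real.cos (s * Real.sqrt x)) A)
      (-cfc (fun x : ℝ => Real.sqrt x * Real.sin (t * Real.sqrt x)) A) t := by
  have hcos (s : ℝ) : ContinuousOn (fun x : ℝ => Real.cos (s * Real.sqrt x)) (spectrum ℝ A) := by
    fun_prop
  have hsin : ContinuousOn (fun x : ℝ => Real.sqrt x * Real.sin (t * Real.sqrt x))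
      (spectrum ℝ A) := by
    fun_prop
  rw [hasDerivAt_iff_isLittleO]
  refine Asymptotics.IsBigO.trans_isLittleO (g := fun s : ℝ => ‖s - t‖ ^ 2) ?_
    (Asymptotics.isLittleO_pow_sub_sub t one_lt_two)
  refine Asymptotics.IsBigO.of_bound ‖A‖ (Filter.Eventually.of_forall fun s => ?_)
  rw [smul_neg, sub_neg_eq_add, ← cfc_sub _ _ A (hcos s) (hcos t), ← cfc_smul _ _ A hsin,
    ← cfc_add A (fun x => Real.cos (s * √x) - Real.cos (t * √x))
      (fun x => (s - t) • (√x * Real.sin (t * √x))) ((hcos s).sub (hcos t)) (hsin.const_smul (s - t))]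
  refine norm_cfc_le (by positivity) fun x hx => ?_
  have hx0 : 0 ≤ x := hc.le.trans (hspec hx)
  have hxA : x ≤ ‖A‖ := (le_abs_self x).trans (spectrum.norm_le_norm_of_mem hx)
  calc ‖Real.cos (s * √x) - Real.cos (t * √x) + (s - t) • (√x * Real.sin (t * √x))‖
      = |Real.cos (s * √x) - Real.cos (t * √x)
          + (s * √x - t * √x) * Real.sin (t * √x)| := by
        rw [Real.norm_eq_abs, smul_eq_mul]
        ring_nf
    _ ≤ |s * √x - t * √x| ^ 2 := Real.abs_cos_sub_cos_add_mul_sin_le _ _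
    _ = x * (s - t) ^ 2 := by
        rw [sq_abs, ← sub_mul, mul_pow, Real.sq_sqrt hx0, mul_comm]
    _ ≤ ‖A‖ * ‖‖s - t‖ ^ 2‖ := by
        rw [norm_pow, norm_norm, Real.norm_eq_abs (s - t), sq_abs]
        gcongr
end

section
/- For every t ∈ ℝ, the operator-valued map t ↦ S_t = cfc(x ↦ sin(t√x)/√x, A) is norm-differentiable at t, with derivative equal to C_t = cfc(x ↦ cos(t√x), A). -/
/-- The first-order Taylor remainder of the sine is bounded by the square of the increment. -/
lemma Real.abs_sin_sub_sin_sub_mul_cos_le (a b : ℝ) :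
    |Real.sin b - Real.sin a - (b - a) * Real.cos a| ≤ (b - a) ^ 2 := by
  have hderiv : ∀ x ∈ Set.uIcc a b,
      HasDerivWithinAt (fun x => Real.sin x - x * Real.cos a)
        (Real.cos x - Real.cos a) (Set.uIcc a b) x := fun x _ => by
    simpa using! ((Real.hasDerivAt_sin x).sub
      ((hasDerivAt_id x).mul_const (Real.cos a))).hasDerivWithinAt
  have hbound : ∀ x ∈ Set.uIcc a b, ‖Real.cos x - Real.cos a‖ ≤ |b - a| := fun x hx =>
    (Real.abs_cos_sub_cos_le x a).trans (Set.abs_sub_left_of_mem_uIcc hx)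
  have h := (convex_uIcc a b).norm_image_sub_le_of_norm_hasDerivWithin_le hderiv hbound
    Set.left_mem_uIcc Set.right_mem_uIcc
  rw [Real.norm_eq_abs, Real.norm_eq_abs, abs_mul_abs_self, ← sq] at h
  convert h using 2
  ring

/-- A function whose first-order remainder at `t` is quadratically bounded is differentiable
at `t`. -/
lemma HasDerivAt.of_norm_sub_le_mul_sq {E : Type*} [NormedAddCommGroup E] [NormedSpace ℝ E]
    {f : ℝ → E} {f' : E} {t M : ℝ}
    (h : ∀ s, ‖f s - f t - (s - t) • f'‖ ≤ M * (s - t) ^ 2) : HasDerivAt f f' t := by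
  rw [hasDerivAt_iff_isLittleO]
  have hO : (fun s => f s - f t - (s - t) • f') =O[nhds t] fun s => (s - t) ^ 2 :=
    Asymptotics.IsBigO.of_bound M <| .of_forall fun s => by
      simpa [abs_of_nonneg (sq_nonneg (s - t))] using h s
  refine hO.trans_isLittleO ?_
  simpa using Asymptotics.isLittleO_pow_sub_sub t one_lt_two


/-- For a bounded self-adjoint operator `A` on a nontrivial complex Hilbert space with
real spectrum contained in `[c, ∞)`, `c > 0`, the map
`t ↦ S_t = cfc (fun x => sin (t√x)/√x) A` is norm-differentiable at every `t`,
with derivative `C_t = cfc (fun x => cos (t√x)) A`. -/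
theorem sin_div_sqrt_cfc_hasDerivAt
    {H : Type*} [NormedAddCommGroup H] [InnerProductSpace ℂ H]
    [CompleteSpace H] [Nontrivial H]
    (A : H →L[ℂ] H) (hA : IsSelfAdjoint A)
    (c : ℝ) (hc : 0 < c) (hspec : spectrum ℝ A ⊆ Set.Ici c) (t : ℝ) :
    HasDerivAt (fun s : ℝ => cfc (fun x : ℝ => Real.sin (s * Real.sqrt x) / Real.sqrt x) A)
      (cfc (fun x : ℝ => Real.cos (t * Real.sqrt x)) A) t := by
  have hpos : ∀ x ∈ spectrum ℝ A, 0 < √x := fun x hx =>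
    Real.sqrt_pos.2 (hc.trans_le (hspec hx))
  have hsin : ∀ s : ℝ, ContinuousOn (fun x => Real.sin (s * √x) / √x) (spectrum ℝ A) :=
    fun s => ContinuousOn.div (by fun_prop) (by fun_prop) fun x hx => (hpos x hx).ne'
  have hcos : ContinuousOn (fun x => Real.cos (t * √x)) (spectrum ℝ A) := by fun_prop
  refine HasDerivAt.of_norm_sub_le_mul_sq (M := √‖A‖) fun s => ?_
  rw [← cfc_sub _ _ A (hsin s) (hsin t), ← cfc_smul (s - t) _ A hcos,
    ← cfc_sub (fun x => Real.sin (s * √x) / √x - Real.sin (t * √x) / √x)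
      (fun x => (s - t) • Real.cos (t * √x)) A ((hsin s).sub (hsin t)) (hcos.const_smul (s - t))]
  refine norm_cfc_le (by positivity) fun x hx => ?_
  have hr := hpos x hx
  have hle : √x ≤ √‖A‖ :=
    Real.sqrt_le_sqrt ((le_abs_self x).trans (spectrum.norm_le_norm_of_mem hx))
  have hrem := Real.abs_sin_sub_sin_sub_mul_cos_le (t * √x) (s * √x)
  rw [Real.norm_eq_abs, smul_eq_mul]
  calc |Real.sin (s * √x) / √x - Real.sin (t * √x) / √x - (s - t) * Real.cos (t * √x)|
      = |Real.sin (s * √x) - Real.sin (t * √x)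
          - (s * √x - t * √x) * Real.cos (t * √x)| / √x := by
        rw [← abs_of_pos hr, ← abs_div, abs_of_pos hr]
        congr 1
        field_simp
    _ ≤ (s * √x - t * √x) ^ 2 / √x := by gcongr
    _ = √x * (s - t) ^ 2 := by field_simp
    _ ≤ √‖A‖ * (s - t) ^ 2 := by gcongr
end

section
/- For each fixed t′ ∈ ℝ, the map t ↦ G(t,t′) is twice norm-differentiable and satisfies ∂_t²G(t,t′) + A ∘ G(t,t′) = 0 for all t; likewise, for each fixed t, the map t′ ↦ G(t,t′) is twice norm-differentiable and satisfies ∂_{t′}²G(t,t′) + A ∘ G(t,t′) = 0. Moreover G attains the prescribed initial data: G(0,0) = B_φφ, ∂_t G(0,0) = B_πφ, ∂_{t′} G(0,0) = B_φπ, and ∂_t ∂_{t′} G(0,0) = B_ππ. -/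
section FunctionalCalculus

variable {𝒜 : Type*} [CStarAlgebra 𝒜] {a : 𝒜}

/-- A functional calculus `t ↦ cfc (F t) a` may be differentiated under `cfc` if the derivative
of `F` in the parameter is Lipschitz, uniformly on the spectrum. -/
theorem hasDerivAt_cfc_of_lipschitz (ha : IsSelfAdjoint a) {F F' : ℝ → ℝ → ℝ} {M : ℝ}
    (hM : 0 ≤ M) (hF : ∀ t, ContinuousOn (F t) (spectrum ℝ a))
    (hF' : ∀ t, ContinuousOn (F' t) (spectrum ℝ a))
    (hderiv : ∀ x ∈ spectrum ℝ a, ∀ t, HasDerivAt (fun s => F s x) (F' t x) t)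
    (hlip : ∀ x ∈ spectrum ℝ a, ∀ s t, |F' s x - F' t x| ≤ M * |s - t|) (t : ℝ) :
    HasDerivAt (fun s => cfc (F s) a) (cfc (F' t) a) t := by
  have scalar_bound : ∀ s, ∀ x ∈ spectrum ℝ a,
      ‖F s x - F t x - (s - t) * F' t x‖ ≤ M * |s - t| * |s - t| := by
    intro s x hx
    have hd : ∀ r ∈ Set.uIcc t s, HasDerivWithinAt (fun r => F r x - r * F' t x)
        (F' r x - F' t x) (Set.uIcc t s) r := fun r _ => by
      have h := (hderiv x hx r).fun_sub ((hasDerivAt_id' r).mul_const (F' t x))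
      rw [one_mul] at h
      exact h.hasDerivWithinAt
    have hb : ∀ r ∈ Set.uIcc t s, ‖F' r x - F' t x‖ ≤ M * |s - t| := fun r hr =>
      (hlip x hx r t).trans
        (mul_le_mul_of_nonneg_left (Set.abs_sub_left_of_mem_uIcc hr) hM)
    have := Convex.norm_image_sub_le_of_norm_hasDerivWithin_le hd hb (convex_uIcc t s)
      Set.left_mem_uIcc Set.right_mem_uIcc
    rw [Real.norm_eq_abs (s - t)] at this
    refine le_of_eq_of_le (congrArg _ ?_) this
    ring
  rw [hasDerivAt_iff_isLittleO]
  have hO : (fun s => cfc (F s) a - cfc (F t) a - (s - t) • cfc (F' t) a) =O[nhds t]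
      fun s => (s - t) ^ 2 := by
    refine Asymptotics.IsBigO.of_bound M (Filter.Eventually.of_forall fun s => ?_)
    rw [← cfc_sub _ _ a (hF s) (hF t), ← cfc_smul (s - t) _ a (hF' t),
      ← cfc_sub (fun x => F s x - F t x) (fun x => (s - t) • F' t x) a
        ((hF s).sub (hF t)) ((hF' t).const_smul (s - t))]
    refine norm_cfc_le (by positivity) fun x hx => (scalar_bound s x hx).trans_eq ?_
    rw [norm_pow, Real.norm_eq_abs]
    ring
  refine hO.trans_isLittleO ?_
  have h := (Asymptotics.isLittleO_pow_id (𝕜 := ℝ) one_lt_two).comp_tendsto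
    (tendsto_sub_nhds_zero_iff.mpr (Filter.tendsto_id (x := nhds t)))
  exact h

theorem continuousOn_sin_mul_sqrt_div_sqrt (t : ℝ) :
    ContinuousOn (fun x : ℝ => Real.sin (t * √x) / √x) (Set.Ioi 0) :=
  ContinuousOn.div (by fun_prop) (by fun_prop) fun _ hx => (Real.sqrt_pos.mpr hx).ne'

theorem exists_bound_spectrum (a : 𝒜) :
    ∃ M : ℝ, 0 ≤ M ∧ ∀ x ∈ spectrum ℝ a, x ≤ M ∧ √x ≤ M := by
  obtain ⟨M, hM⟩ := (spectrum.isCompact (𝕜 := ℝ) a).bddAbove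
  refine ⟨max M (√M), (Real.sqrt_nonneg M).trans (le_max_right _ _), fun x hx => ⟨?_, ?_⟩⟩
  · exact (hM hx).trans (le_max_left _ _)
  · exact (Real.sqrt_le_sqrt (hM hx)).trans (le_max_right _ _)

theorem hasDerivAt_cfc_cos_mul_sqrt (ha : IsSelfAdjoint a) (hpos : spectrum ℝ a ⊆ Set.Ioi 0)
    (t : ℝ) :
    HasDerivAt (fun s : ℝ => cfc (fun x : ℝ => Real.cos (s * √x)) a)
      (-(a * cfc (fun x : ℝ => Real.sin (t * √x) / √x) a)) t := by
  obtain ⟨M, hM, hbound⟩ := exists_bound_spectrum a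
  have key := hasDerivAt_cfc_of_lipschitz ha (F := fun s x => Real.cos (s * √x))
    (F' := fun s x => -(Real.sin (s * √x) * √x)) hM
    (fun s => by fun_prop) (fun s => by fun_prop)
    (fun x _ s => by simpa using ((hasDerivAt_id s).mul_const √x).cos)
    (fun x hx s r => by
      have hx0 : 0 ≤ x := (hpos hx).le
      calc |-(Real.sin (s * √x) * √x) - -(Real.sin (r * √x) * √x)|
          = |Real.sin (s * √x) - Real.sin (r * √x)| * √x := by
            rw [← abs_of_nonneg (Real.sqrt_nonneg x), ← abs_mul, ← abs_neg,
              abs_of_nonneg (Real.sqrt_nonneg x)]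
            ring_nf
        _ ≤ |s * √x - r * √x| * √x :=
            mul_le_mul_of_nonneg_right (Real.abs_sin_sub_sin_le _ _) (Real.sqrt_nonneg x)
        _ = x * |s - r| := by
            rw [← sub_mul, abs_mul, abs_of_nonneg (Real.sqrt_nonneg x), mul_assoc,
              Real.mul_self_sqrt hx0, mul_comm]
        _ ≤ M * |s - r| := mul_le_mul_of_nonneg_right (hbound x hx).1 (abs_nonneg _)) t
  convert key using 1
  have hmul := cfc_mul (fun x : ℝ => x) (fun x : ℝ => Real.sin (t * √x) / √x) a (by fun_prop)
    ((continuousOn_sin_mul_sqrt_div_sqrt t).mono hpos)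
  rw [cfc_id' ℝ a] at hmul
  rw [← hmul, ← cfc_neg]
  refine cfc_congr fun x hx => ?_
  have hx0 : 0 < x := hpos hx
  have h := Real.sqrt_pos.mpr hx0
  have hsq := Real.mul_self_sqrt hx0.le
  field_simp
  linear_combination Real.sin (t * √x) * hsq

theorem hasDerivAt_cfc_sin_mul_sqrt_div_sqrt (ha : IsSelfAdjoint a)
    (hpos : spectrum ℝ a ⊆ Set.Ioi 0) (t : ℝ) :
    HasDerivAt (fun s : ℝ => cfc (fun x : ℝ => Real.sin (s * √x) / √x) a)
      (cfc (fun x : ℝ => Real.cos (t * √x)) a) t := by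
  obtain ⟨M, hM, hbound⟩ := exists_bound_spectrum a
  refine hasDerivAt_cfc_of_lipschitz ha (F := fun s x => Real.sin (s * √x) / √x)
    (F' := fun s x => Real.cos (s * √x)) hM
    (fun s => (continuousOn_sin_mul_sqrt_div_sqrt s).mono hpos) (fun s => by fun_prop)
    (fun x hx s => ?_) (fun x hx s r => ?_) t
  · have h : √x ≠ 0 := (Real.sqrt_pos.mpr (hpos hx)).ne'
    simpa [h] using (((hasDerivAt_id s).mul_const √x).sin).div_const √x
  · calc |Real.cos (s * √x) - Real.cos (r * √x)| ≤ |s * √x - r * √x| :=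
          Real.abs_cos_sub_cos_le _ _
      _ = √x * |s - r| := by
          rw [← sub_mul, abs_mul, abs_of_nonneg (Real.sqrt_nonneg x), mul_comm]
      _ ≤ M * |s - r| := mul_le_mul_of_nonneg_right (hbound x hx).2 (abs_nonneg _)

end FunctionalCalculus

section OperatorCosine

variable {𝒜 : Type*} [NormedRing 𝒜] [NormedAlgebra ℝ 𝒜] {a : 𝒜} {C S : ℝ → 𝒜}

theorem hasDerivAt_cosine_mul_add_sine_mul (hC : ∀ t, HasDerivAt C (-(a * S t)) t)
    (hS : ∀ t, HasDerivAt S (C t) t) (X Y : 𝒜) (t : ℝ) :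
    HasDerivAt (fun t => C t * X + S t * Y) (-(a * S t) * X + C t * Y) t :=
  ((hC t).mul_const X).add ((hS t).mul_const Y)

/-- The combinations `C t * X + S t * Y` of an operator cosine and sine solve `u'' + a u = 0`. -/
theorem cosine_mul_add_sine_mul_solves (hC : ∀ t, HasDerivAt C (-(a * S t)) t)
    (hS : ∀ t, HasDerivAt S (C t) t) (X Y : 𝒜) :
    Differentiable ℝ (fun t => C t * X + S t * Y) ∧
      Differentiable ℝ (deriv fun t => C t * X + S t * Y) ∧
      ∀ t, deriv (deriv fun t => C t * X + S t * Y) t + a * (C t * X + S t * Y) = 0 := by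
  have h1 := hasDerivAt_cosine_mul_add_sine_mul hC hS X Y
  have h2 : ∀ t, HasDerivAt (deriv fun t => C t * X + S t * Y)
      (-(a * C t) * X + -(a * S t) * Y) t := by
    rw [funext fun t => (h1 t).deriv]
    exact fun t => (((hS t).const_mul a).neg.mul_const X).add ((hC t).mul_const Y)
  refine ⟨fun t => (h1 t).differentiableAt, fun t => (h2 t).differentiableAt, fun t => ?_⟩
  rw [(h2 t).deriv]
  noncomm_ring

end OperatorCosine

/-- **The Wightman two-point function solves the Klein–Gordon equation in both arguments
and attains its Cauchy data.**  Let `A` be a bounded self-adjoint operator on a nontrivial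
complex Hilbert space with real spectrum contained in `[c, ∞)`, `c > 0`.  Given bounded
operators `Bφφ, Bφπ, Bπφ, Bππ` (the initial data), define
`G t t' = C_t ∘ C_{t'} ∘ Bφφ + C_t ∘ S_{t'} ∘ Bφπ + S_t ∘ C_{t'} ∘ Bπφ + S_t ∘ S_{t'} ∘ Bππ`
where `C_t = cfc (fun x => cos (t√x)) A` and `S_t = cfc (fun x => sin (t√x)/√x) A`.
Then for each fixed `t'` the map `t ↦ G t t'` is twice norm-differentiable with
`∂_t² G + A ∘ G = 0`, likewise in the second argument, and
`G 0 0 = Bφφ`, `∂_t G 0 0 = Bπφ`, `∂_{t'} G 0 0 = Bφπ`, `∂_t∂_{t'} G 0 0 = Bππ`. -/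
theorem wightman_solves_KG_with_initial_data
    {H : Type*} [NormedAddCommGroup H] [InnerProductSpace ℂ H]
    [CompleteSpace H] [Nontrivial H]
    (A : H →L[ℂ] H) (hA : IsSelfAdjoint A)
    (c : ℝ) (hc : 0 < c) (hspec : spectrum ℝ A ⊆ Set.Ici c)
    (Bφφ Bφπ Bπφ Bππ : H →L[ℂ] H)
    (G : ℝ → ℝ → H →L[ℂ] H)
    (hG : ∀ t t' : ℝ, G t t' =
      cfc (fun x : ℝ => Real.cos (t * Real.sqrt x)) A *
        (cfc (fun x : ℝ => Real.cos (t' * Real.sqrt x)) A * Bφφ) +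
      cfc (fun x : ℝ => Real.cos (t * Real.sqrt x)) A *
        (cfc (fun x : ℝ => Real.sin (t' * Real.sqrt x) / Real.sqrt x) A * Bφπ) +
      cfc (fun x : ℝ => Real.sin (t * Real.sqrt x) / Real.sqrt x) A *
        (cfc (fun x : ℝ => Real.cos (t' * Real.sqrt x)) A * Bπφ) +
      cfc (fun x : ℝ => Real.sin (t * Real.sqrt x) / Real.sqrt x) A *
        (cfc (fun x : ℝ => Real.sin (t' * Real.sqrt x) / Real.sqrt x) A * Bππ)) :
    (∀ t' : ℝ, Differentiable ℝ (fun t => G t t') ∧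
      Differentiable ℝ (deriv (fun t => G t t')) ∧
      ∀ t : ℝ, deriv (deriv (fun t => G t t')) t + A * G t t' = 0) ∧
    (∀ t : ℝ, Differentiable ℝ (G t) ∧
      Differentiable ℝ (deriv (G t)) ∧
      ∀ t' : ℝ, deriv (deriv (G t)) t' + A * G t t' = 0) ∧
    G 0 0 = Bφφ ∧
    deriv (fun t => G t 0) 0 = Bπφ ∧
    deriv (G 0) 0 = Bφπ ∧
    deriv (fun t => deriv (G t) 0) 0 = Bππ := by
  have hpos : spectrum ℝ A ⊆ Set.Ioi 0 := fun x hx => hc.trans_le (hspec hx)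
  have hC := hasDerivAt_cfc_cos_mul_sqrt hA hpos
  have hS := hasDerivAt_cfc_sin_mul_sqrt_div_sqrt hA hpos
  have hCC : ∀ t t' : ℝ, Commute (cfc (fun x : ℝ => Real.cos (t * √x)) A)
      (cfc (fun x : ℝ => Real.cos (t' * √x)) A) := fun t t' => cfc_commute_cfc _ _ A
  have hCS : ∀ t t' : ℝ, Commute (cfc (fun x : ℝ => Real.cos (t * √x)) A)
      (cfc (fun x : ℝ => Real.sin (t' * √x) / √x) A) := fun t t' => cfc_commute_cfc _ _ A
  have hSS : ∀ t t' : ℝ, Commute (cfc (fun x : ℝ => Real.sin (t * √x) / √x) A)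
      (cfc (fun x : ℝ => Real.sin (t' * √x) / √x) A) := fun t t' => cfc_commute_cfc _ _ A
  have hC0 : cfc (fun x : ℝ => Real.cos (0 * √x)) A = 1 := by
    simpa using cfc_const_one ℝ A
  have hS0 : cfc (fun x : ℝ => Real.sin (0 * √x) / √x) A = 0 := by
    simp
  generalize hCdef : (fun t : ℝ => cfc (fun x : ℝ => Real.cos (t * √x)) A) = C at *
  generalize hSdef : (fun t : ℝ => cfc (fun x : ℝ => Real.sin (t * √x) / √x) A) = S at *
  simp only [fun t => congrFun hCdef t, fun t => congrFun hSdef t] at *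
  have hG₁ : ∀ t', (fun t => G t t') =
      fun t => C t * (C t' * Bφφ + S t' * Bφπ) + S t * (C t' * Bπφ + S t' * Bππ) := by
    intro t'
    funext t
    rw [hG]
    noncomm_ring
  have hG₂ : ∀ t, G t =
      fun t' => C t' * (C t * Bφφ + S t * Bπφ) + S t' * (C t * Bφπ + S t * Bππ) := by
    intro t
    funext t'
    rw [hG]
    simp only [mul_add, ← mul_assoc, (hCC t t').eq, (hCS t t').eq, (hCS t' t).eq, (hSS t t').eq]
    abel
  have hderiv₂ : ∀ t, deriv (G t) 0 = C t * Bφπ + S t * Bππ := by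
    intro t
    rw [hG₂, (hasDerivAt_cosine_mul_add_sine_mul hC hS _ _ 0).deriv]
    simp [hC0, hS0]
  refine ⟨fun t' => ?_, fun t => ?_, ?_, ?_, ?_, ?_⟩
  · have h := cosine_mul_add_sine_mul_solves hC hS (C t' * Bφφ + S t' * Bφπ)
      (C t' * Bπφ + S t' * Bππ)
    rw [← hG₁] at h
    refine ⟨h.1, h.2.1, fun t => ?_⟩
    rw [show G t t' = _ from congrFun (hG₁ t') t]
    exact h.2.2 t
  · rw [hG₂]
    exact cosine_mul_add_sine_mul_solves hC hS _ _
  · simp [hG, hC0, hS0]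
  · rw [hG₁, (hasDerivAt_cosine_mul_add_sine_mul hC hS _ _ 0).deriv]
    simp [hC0, hS0]
  · simp [hderiv₂, hC0, hS0]
  · rw [funext hderiv₂, (hasDerivAt_cosine_mul_add_sine_mul hC hS _ _ 0).deriv]
    simp [hC0, hS0]
end

section
/- Suppose G(t+s, t′+s) = G(t, t′) for all t, t′, s ∈ ℝ (time-translation invariance). Then the initial data satisfy B_ππ = A ∘ B_φφ and B_φπ = −B_πφ. If, in addition, the canonical commutation relation B_φπ − B_πφ = i·Id holds, then B_φπ = (i/2)·Id and B_πφ = −(i/2)·Id. -/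
/-- If the equal-time combination of `X, Y, Z, W` evolved by commuting units `C, S` with
`C² + S² A = 1` is `X`, for `S` as well as for `-S`, then `W = A X` and `Y = -Z`. -/
theorem eq_mul_and_eq_neg_of_cos_sin_evolution {R : Type*} [Ring R] [Module ℂ R]
    {A C S X Y Z W : R} (hcomm : Commute C S) (hpyth : C * C + S * (S * A) = 1)
    (hC : IsUnit C) (hS : IsUnit S)
    (hpos : C * (C * X) + C * (S * Y) + S * (C * Z) + S * (S * W) = X)
    (hneg : C * (C * X) + C * (-S * Y) + -S * (C * Z) + -S * (-S * W) = X) :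
    W = A * X ∧ Y = -Z := by
  simp only [neg_mul, mul_neg, neg_neg] at hneg
  have hcross : C * (S * Y) + S * (C * Z) = 0 := by
    have htwo : (2 : ℂ) • (C * (S * Y) + S * (C * Z)) = 0 := by
      have h := sub_eq_zero.2 (hpos.trans hneg.symm)
      rw [← h]
      module
    exact (smul_eq_zero_iff_right two_ne_zero).1 htwo
  have hdiag : C * (C * X) + S * (S * W) = X := by
    rw [add_assoc (C * (C * X)), hcross, add_zero] at hpos
    exact hpos
  have hX : C * (C * X) + S * (S * (A * X)) = X := by
    have h := congrArg (· * X) hpyth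
    simpa only [add_mul, mul_assoc, one_mul] using h
  refine ⟨hS.mul_left_cancel (hS.mul_left_cancel (add_left_cancel (hdiag.trans hX.symm))), ?_⟩
  rw [← mul_assoc S C, ← hcomm.eq, mul_assoc, ← mul_add, ← mul_add, hC.mul_right_eq_zero,
    hS.mul_right_eq_zero] at hcross
  exact eq_neg_of_add_eq_zero_left hcross

theorem eq_half_smul_of_sub_eq_smul {M : Type*} [AddCommGroup M] [Module ℂ M] {y z m : M} {k : ℂ}
    (hyz : y = -z) (hsub : y - z = k • m) : y = (k / 2) • m ∧ z = -((k / 2) • m) := by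
  have hy : y = (k / 2) • m := by
    rw [div_eq_inv_mul, mul_smul, ← hsub, hyz]
    module
  exact ⟨hy, by rw [← hy, hyz, neg_neg]⟩

/-- **Cauchy data of time-translation invariant states (forward direction).**
With `A`, `Bφφ, Bφπ, Bπφ, Bππ` and
`G t t' = C_t ∘ C_{t'} ∘ Bφφ + C_t ∘ S_{t'} ∘ Bφπ + S_t ∘ C_{t'} ∘ Bπφ + S_t ∘ S_{t'} ∘ Bππ`
as in the paper, if `G (t+s) (t'+s) = G t t'` for all `t, t', s`, then
`Bππ = A ∘ Bφφ` and `Bφπ = −Bπφ`; if in addition the canonical commutation relation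
`Bφπ − Bπφ = i·Id` holds, then `Bφπ = (i/2)·Id` and `Bπφ = −(i/2)·Id`. -/
theorem time_translation_invariant_initial_data
    {H : Type*} [NormedAddCommGroup H] [InnerProductSpace ℂ H]
    [CompleteSpace H] [Nontrivial H]
    (A : H →L[ℂ] H) (hA : IsSelfAdjoint A)
    (c : ℝ) (hc : 0 < c) (hspec : spectrum ℝ A ⊆ Set.Ici c)
    (Bφφ Bφπ Bπφ Bππ : H →L[ℂ] H)
    (G : ℝ → ℝ → H →L[ℂ] H)
    (hG : ∀ t t' : ℝ, G t t' =
      cfc (fun x : ℝ => Real.cos (t * Real.sqrt x)) A *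
        (cfc (fun x : ℝ => Real.cos (t' * Real.sqrt x)) A * Bφφ) +
      cfc (fun x : ℝ => Real.cos (t * Real.sqrt x)) A *
        (cfc (fun x : ℝ => Real.sin (t' * Real.sqrt x) / Real.sqrt x) A * Bφπ) +
      cfc (fun x : ℝ => Real.sin (t * Real.sqrt x) / Real.sqrt x) A *
        (cfc (fun x : ℝ => Real.cos (t' * Real.sqrt x)) A * Bπφ) +
      cfc (fun x : ℝ => Real.sin (t * Real.sqrt x) / Real.sqrt x) A *
        (cfc (fun x : ℝ => Real.sin (t' * Real.sqrt x) / Real.sqrt x) A * Bππ))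
    (hinv : ∀ t t' s : ℝ, G (t + s) (t' + s) = G t t') :
    Bππ = A * Bφφ ∧ Bφπ = -Bπφ ∧
    (Bφπ - Bπφ = Complex.I • (1 : H →L[ℂ] H) →
      Bφπ = (Complex.I / 2) • (1 : H →L[ℂ] H) ∧
      Bπφ = -((Complex.I / 2) • (1 : H →L[ℂ] H))) := by
  have hpos : ∀ x ∈ spectrum ℝ A, 0 < Real.sqrt x := fun x hx =>
    Real.sqrt_pos.2 (hc.trans_le (hspec hx))
  set s : ℝ := 1 / (1 + Real.sqrt ‖A‖) with hs
  have hs0 : 0 < s := by positivity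
  have hsmall : ∀ x ∈ spectrum ℝ A, 0 < s * Real.sqrt x ∧ s * Real.sqrt x ≤ 1 := by
    intro x hx
    refine ⟨mul_pos hs0 (hpos x hx), ?_⟩
    have hx' : x ≤ ‖A‖ := (le_abs_self x).trans (spectrum.norm_le_norm_of_mem hx)
    rw [hs, one_div, inv_mul_le_iff₀ (by positivity)]
    linarith [Real.sqrt_le_sqrt hx']
  have hcosc : ContinuousOn (fun x : ℝ => Real.cos (s * Real.sqrt x)) (spectrum ℝ A) := by
    fun_prop
  have hsinc : ContinuousOn (fun x : ℝ => Real.sin (s * Real.sqrt x) / Real.sqrt x)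
      (spectrum ℝ A) :=
    ContinuousOn.div (by fun_prop) (by fun_prop) fun x hx => (hpos x hx).ne'
  have hsinx : ContinuousOn (fun x : ℝ => Real.sin (s * Real.sqrt x) / Real.sqrt x * x)
      (spectrum ℝ A) := hsinc.mul continuousOn_id
  have hC0 : cfc (fun x : ℝ => Real.cos (0 * Real.sqrt x)) A = 1 := by
    simp [cfc_const_one ℝ A]
  have hS0 : cfc (fun x : ℝ => Real.sin (0 * Real.sqrt x) / Real.sqrt x) A = 0 := by
    simp [cfc_const_zero ℝ A]
  have hCneg : cfc (fun x : ℝ => Real.cos (-s * Real.sqrt x)) A =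
      cfc (fun x : ℝ => Real.cos (s * Real.sqrt x)) A := by
    simp only [neg_mul, Real.cos_neg]
  have hSneg : cfc (fun x : ℝ => Real.sin (-s * Real.sqrt x) / Real.sqrt x) A =
      -cfc (fun x : ℝ => Real.sin (s * Real.sqrt x) / Real.sqrt x) A := by
    simp only [neg_mul, Real.sin_neg, neg_div, cfc_neg]
  have hfwd := hinv 0 0 s
  have hbwd := hinv 0 0 (-s)
  simp only [zero_add, hG, hC0, hS0, hCneg, hSneg] at hfwd hbwd
  simp only [one_mul, zero_mul, mul_zero, add_zero] at hfwd hbwd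
  have hCu : IsUnit (cfc (fun x : ℝ => Real.cos (s * Real.sqrt x)) A) := by
    rw [isUnit_cfc_iff _ A]
    intro x hx
    exact (Real.cos_pos_of_le_one (abs_le.2 ⟨by linarith [hsmall x hx], (hsmall x hx).2⟩)).ne'
  have hSu : IsUnit (cfc (fun x : ℝ => Real.sin (s * Real.sqrt x) / Real.sqrt x) A) := by
    rw [isUnit_cfc_iff _ A]
    intro x hx
    exact (div_pos (Real.sin_pos_of_pos_of_le_one (hsmall x hx).1 (hsmall x hx).2)
      (hpos x hx)).ne'
  have hpyth : cfc (fun x : ℝ => Real.cos (s * Real.sqrt x)) A *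
        cfc (fun x : ℝ => Real.cos (s * Real.sqrt x)) A +
      cfc (fun x : ℝ => Real.sin (s * Real.sqrt x) / Real.sqrt x) A *
        (cfc (fun x : ℝ => Real.sin (s * Real.sqrt x) / Real.sqrt x) A * A) = 1 := by
    nth_rewrite 5 [← cfc_id' ℝ A]
    rw [← cfc_mul _ _ A hcosc hcosc, ← cfc_mul _ _ A hsinc (by fun_prop),
      ← cfc_mul _ _ A hsinc hsinx,
      ← cfc_add A _ _ (hcosc.fun_mul hcosc) (hsinc.fun_mul hsinx),
      ← cfc_const_one ℝ A]
    refine cfc_congr fun x hx => ?_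
    have hx0 := (hpos x hx).ne'
    have hxx : Real.sqrt x ^ 2 = x := Real.sq_sqrt (hc.le.trans (hspec hx))
    have h := Real.sin_sq_add_cos_sq (s * Real.sqrt x)
    field_simp
    rw [hxx]
    linear_combination x * h
  have hcomm : Commute (cfc (fun x : ℝ => Real.cos (s * Real.sqrt x)) A)
      (cfc (fun x : ℝ => Real.sin (s * Real.sqrt x) / Real.sqrt x) A) :=
    cfc_commute_cfc _ _ A
  obtain ⟨hππ, hφπ⟩ := eq_mul_and_eq_neg_of_cos_sin_evolution hcomm hpyth hCu hSu hfwd hbwd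
  exact ⟨hππ, hφπ, eq_half_smul_of_sub_eq_smul hφπ⟩
end

section
/- The function G satisfies G(t+s, t′+s) = G(t, t′) for all t, t′, s ∈ ℝ if and only if c_ππ = a²·c_φφ and c_φπ = −c_πφ. If in addition the canonical commutation relation c_φπ − c_πφ = i holds, then G is invariant under simultaneous time translations if and only if c_ππ = a²·c_φφ, c_φπ = i/2 and c_πφ = −i/2, in which case G(t,t′) = cos(a(t−t′))·c_φφ − i·sin(a(t−t′))/(2a) for all t, t′. -/
/-- Single-mode form of the Wightman two-point function of a Klein–Gordon field in an
ultrastatic spacetime, expressed in terms of its Cauchy data `cφφ, cφπ, cπφ, cππ`. -/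
noncomputable def Gmode (a : ℝ) (cφφ cφπ cπφ cππ : ℂ) (t t' : ℝ) : ℂ :=
  (Real.cos (a * t) * Real.cos (a * t') : ℝ) * cφφ +
  (Real.cos (a * t) * (Real.sin (a * t') / a) : ℝ) * cφπ +
  ((Real.sin (a * t) / a) * Real.cos (a * t') : ℝ) * cπφ +
  ((Real.sin (a * t) * Real.sin (a * t')) / a ^ 2 : ℝ) * cππ

/-- `Gmode` depends only on `t - t'` once the Cauchy data satisfy the invariance constraints. -/
theorem Gmode_eq_of_constraints {a : ℝ} (ha : a ≠ 0) (cφφ cφπ : ℂ) (t t' : ℝ) :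
    Gmode a cφφ cφπ (-cφπ) ((a : ℂ) ^ 2 * cφφ) t t' =
      (Real.cos (a * (t - t')) : ℝ) * cφφ - (Real.sin (a * (t - t')) : ℝ) / a * cφπ := by
  have ha' : (a : ℂ) ≠ 0 := Complex.ofReal_ne_zero.mpr ha
  rw [Gmode, mul_sub, Real.cos_sub, Real.sin_sub]
  push_cast
  field_simp
  ring

theorem Gmode_translation_invariant_iff {a : ℝ} (ha : a ≠ 0) (cφφ cφπ cπφ cππ : ℂ) :
    (∀ t t' s : ℝ, Gmode a cφφ cφπ cπφ cππ (t + s) (t' + s) =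
        Gmode a cφφ cφπ cπφ cππ t t') ↔
      (cππ = (a : ℂ) ^ 2 * cφφ ∧ cφπ = -cπφ) := by
  have ha' : (a : ℂ) ≠ 0 := Complex.ofReal_ne_zero.mpr ha
  constructor
  · intro h
    have quarter : a * (Real.pi / 2 / a) = Real.pi / 2 := mul_div_cancel₀ _ ha
    have half : a * (Real.pi / 2 / a + Real.pi / 2 / a) = Real.pi := by
      rw [mul_add, quarter, add_halves]
    have h₁ := h 0 0 (Real.pi / 2 / a)
    have h₂ := h 0 (Real.pi / 2 / a) (Real.pi / 2 / a)
    simp only [Gmode, zero_add, quarter, half, mul_zero, Real.cos_zero, Real.sin_zero,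
      Real.cos_pi_div_two, Real.sin_pi_div_two, Real.cos_pi, Real.sin_pi] at h₁ h₂
    push_cast at h₁ h₂
    field_simp at h₁ h₂
    exact ⟨by linear_combination h₁, mul_left_cancel₀ ha' (by linear_combination -h₂)⟩
  · rintro ⟨rfl, hc⟩ t t' s
    obtain rfl : cπφ = -cφπ := by rw [hc, neg_neg]
    rw [Gmode_eq_of_constraints ha, Gmode_eq_of_constraints ha, add_sub_add_right_eq_sub]

/-- **Single-mode characterization of time-translation invariant states.**
For `a > 0`: `Gmode` is invariant under simultaneous time translations iff
`cππ = a²·cφφ` and `cφπ = −cπφ`.  If moreover the canonical commutation relation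
`cφπ − cπφ = i` holds, then invariance holds iff `cππ = a²·cφφ`, `cφπ = i/2` and
`cπφ = −i/2`, in which case `G t t' = cos(a(t−t'))·cφφ − i·sin(a(t−t'))/(2a)`. -/
theorem gmode_time_translation_invariance_iff (a : ℝ) (ha : 0 < a)
    (cφφ cφπ cπφ cππ : ℂ) :
    ((∀ t t' s : ℝ, Gmode a cφφ cφπ cπφ cππ (t + s) (t' + s) =
        Gmode a cφφ cφπ cπφ cππ t t') ↔
      (cππ = (a : ℂ) ^ 2 * cφφ ∧ cφπ = -cπφ)) ∧
    (cφπ - cπφ = Complex.I →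
      (((∀ t t' s : ℝ, Gmode a cφφ cφπ cπφ cππ (t + s) (t' + s) =
          Gmode a cφφ cφπ cπφ cππ t t') ↔
        (cππ = (a : ℂ) ^ 2 * cφφ ∧ cφπ = Complex.I / 2 ∧ cπφ = -(Complex.I / 2))) ∧
      ((∀ t t' s : ℝ, Gmode a cφφ cφπ cπφ cππ (t + s) (t' + s) =
          Gmode a cφφ cφπ cπφ cππ t t') →
        ∀ t t' : ℝ, Gmode a cφφ cφπ cπφ cππ t t' =
          (Real.cos (a * (t - t')) : ℝ) * cφφ -
            Complex.I * (Real.sin (a * (t - t')) : ℝ) / (2 * a)))) := by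
  have inv_iff := Gmode_translation_invariant_iff ha.ne' cφφ cφπ cπφ cππ
  refine ⟨inv_iff, fun hccr => ?_⟩
  have ccr_iff : (cππ = (a : ℂ) ^ 2 * cφφ ∧ cφπ = -cπφ) ↔
      (cππ = (a : ℂ) ^ 2 * cφφ ∧ cφπ = Complex.I / 2 ∧ cπφ = -(Complex.I / 2)) := by
    refine and_congr_right fun _ => ⟨fun h => ⟨?_, ?_⟩, fun ⟨h, h'⟩ => ?_⟩
    · linear_combination (hccr + h) / 2
    · linear_combination (h - hccr) / 2
    · rw [h, h', neg_neg]
  refine ⟨inv_iff.trans ccr_iff, fun hinv t t' => ?_⟩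
  obtain ⟨rfl, rfl, rfl⟩ := ccr_iff.mp (inv_iff.mp hinv)
  rw [Gmode_eq_of_constraints ha.ne']
  ring
end

section
/- For every continuous compactly supported function f : ℝ³ → ℂ and every continuous function v : ℝ³ → ℂ, one has lim_{ε→0⁺} −(ε/(4π²)) ∫_{ℝ³} f(x)·( −1/(σ(x) + ε²/2)² + v(x)/(σ(x) + ε²/2) ) dx = f(0), where σ(x) := |x|²/2. In particular the family of functions x ↦ −(ε/(4π²))·( −1/(σ(x)+ε²/2)² + v(x)/(σ(x)+ε²/2) ) converges to the Dirac delta at the origin as ε → 0⁺. -/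
open MeasureTheory

open Filter Topology Set

lemma integrable_smul_of_hasCompactSupport {X E : Type*} [TopologicalSpace X]
    [MeasurableSpace X] [OpensMeasurableSpace X] {μ : Measure X} [IsFiniteMeasureOnCompacts μ]
    [NormedAddCommGroup E] [NormedSpace ℝ E] {k : X → ℝ} {g : X → E} (hk : Continuous k)
    (hg : Continuous g) (hgc : HasCompactSupport g) : Integrable (fun x => k x • g x) μ :=
  (hk.smul hg).integrable_of_hasCompactSupport (HasCompactSupport.smul_left (f := k) hgc)

lemma integral_Ioi_sq_mul_inv_one_add_sq_sq :
    ∫ r in Ioi (0 : ℝ), r ^ 2 * ((1 + r ^ 2) ^ 2)⁻¹ = Real.pi / 4 := by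
  have hderiv : ∀ r ∈ Ici (0 : ℝ),
      HasDerivAt (fun r : ℝ => (Real.arctan r - r / (1 + r ^ 2)) / 2)
        (r ^ 2 * ((1 + r ^ 2) ^ 2)⁻¹) r := by
    intro r _
    have hr : (1 + r ^ 2 : ℝ) ≠ 0 := by positivity
    convert! ((Real.hasDerivAt_arctan r).sub ((hasDerivAt_id r).div
      (((hasDerivAt_id r).pow 2).const_add 1) hr)).div_const 2 using 1
    simp only [id, Nat.cast_ofNat, Pi.pow_apply]
    field_simp
    ring
  have hquot : Tendsto (fun r : ℝ => r / (1 + r ^ 2)) atTop (𝓝 0) := by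
    refine squeeze_zero' ?_ ?_ tendsto_inv_atTop_zero
    · filter_upwards [eventually_gt_atTop 0] with r hr using by positivity
    · filter_upwards [eventually_gt_atTop 0] with r hr
      rw [inv_eq_one_div, div_le_div_iff₀ (by positivity) hr]
      nlinarith
  have hlim : Tendsto (fun r : ℝ => (Real.arctan r - r / (1 + r ^ 2)) / 2) atTop
      (𝓝 ((Real.pi / 2 - 0) / 2)) :=
    (((Real.tendsto_arctan_atTop.mono_right nhdsWithin_le_nhds).sub hquot).div_const 2)
  rw [integral_Ioi_of_hasDerivAt_of_nonneg' hderiv (fun r _ => by positivity) hlim]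
  simp
  ring

lemma integral_inv_one_add_norm_sq_sq :
    ∫ x : EuclideanSpace ℝ (Fin 3), ((1 + ‖x‖ ^ 2) ^ 2)⁻¹ = Real.pi ^ 2 := by
  rw [integral_fun_norm_addHaar volume (fun r : ℝ => ((1 + r ^ 2) ^ 2)⁻¹)]
  simp only [finrank_euclideanSpace, Fintype.card_fin, Nat.add_one_sub_one, smul_eq_mul,
    integral_Ioi_sq_mul_inv_one_add_sq_sq, Measure.real,
    EuclideanSpace.volume_ball_fin_three]
  rw [ENNReal.toReal_mul, ENNReal.toReal_ofReal (by positivity)]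
  simp
  ring

/-- The functions `ε / (π² (‖x‖² + ε²)²)` on `ℝ³` form an approximate identity. -/
lemma tendsto_integral_div_norm_sq_add_sq_sq {f : EuclideanSpace ℝ (Fin 3) → ℂ}
    (hf : Integrable f) (hf0 : ContinuousAt f 0) :
    Tendsto (fun ε : ℝ => ∫ x : EuclideanSpace ℝ (Fin 3),
      (ε / (Real.pi ^ 2 * (‖x‖ ^ 2 + ε ^ 2) ^ 2)) • f x) (𝓝[>] 0) (𝓝 (f 0)) := by
  have hdecay : Tendsto (fun x : EuclideanSpace ℝ (Fin 3) =>
      ‖x‖ ^ Module.finrank ℝ (EuclideanSpace ℝ (Fin 3)) *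
        ((Real.pi ^ 2)⁻¹ * ((1 + ‖x‖ ^ 2) ^ 2)⁻¹)) (Bornology.cobounded _) (𝓝 0) := by
    have hinv := (tendsto_inv_atTop_zero.comp
      (tendsto_norm_cobounded_atTop (E := EuclideanSpace ℝ (Fin 3)))).const_mul (Real.pi ^ 2)⁻¹
    rw [mul_zero] at hinv
    refine squeeze_zero' (Eventually.of_forall fun x => by positivity) ?_ hinv
    filter_upwards [tendsto_norm_cobounded_atTop.eventually_gt_atTop 0] with x hx
    simp only [finrank_euclideanSpace, Fintype.card_fin, Function.comp_apply]
    rw [mul_left_comm]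
    gcongr
    rw [← div_eq_mul_inv, inv_eq_one_div, div_le_div_iff₀ (by positivity) hx]
    nlinarith [sq_nonneg ‖x‖]
  have h := (tendsto_integral_comp_smul_smul_of_integrable (μ := volume)
    (φ := fun x : EuclideanSpace ℝ (Fin 3) => (Real.pi ^ 2)⁻¹ * ((1 + ‖x‖ ^ 2) ^ 2)⁻¹)
    (fun x => by positivity)
    (by rw [integral_const_mul, integral_inv_one_add_norm_sq_sq]
        exact inv_mul_cancel₀ (by positivity))
    hdecay hf hf0).comp tendsto_inv_nhdsGT_zero
  refine h.congr' ?_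
  filter_upwards [self_mem_nhdsWithin] with ε (hε : 0 < ε)
  refine integral_congr_ae (Eventually.of_forall fun x => ?_)
  simp only [finrank_euclideanSpace, Fintype.card_fin, norm_smul, norm_inv, Real.norm_eq_abs,
    abs_of_pos hε]
  congr 1
  field_simp
  ring

lemma integrableOn_ball_inv_norm (R : ℝ) :
    IntegrableOn (fun x : EuclideanSpace ℝ (Fin 3) => ‖x‖⁻¹) (Metric.ball 0 R) := by
  rw [integrableOn_fun_norm_addHaar volume (f := fun r : ℝ => r⁻¹)]
  have hcont : IntegrableOn (fun r : ℝ => r) (Ioo 0 R) :=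
    (continuous_id.integrableOn_Icc (a := 0) (b := R)).mono_set Ioo_subset_Icc_self
  refine hcont.congr_fun (fun r hr => ?_) measurableSet_Ioo
  have := hr.1.ne'
  simp only [finrank_euclideanSpace, Fintype.card_fin, Nat.add_one_sub_one, smul_eq_mul]
  field_simp

lemma tendsto_integral_smul_of_hasCompactSupport {g : EuclideanSpace ℝ (Fin 3) → ℂ}
    (hg : Continuous g) (hgc : HasCompactSupport g) :
    Tendsto (fun ε : ℝ => ∫ x, (ε / (‖x‖ ^ 2 / 2 + ε ^ 2 / 2)) • g x) (𝓝[>] 0) (𝓝 0) := by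
  obtain ⟨C, hC⟩ := hg.bounded_above_of_compact_support hgc
  obtain ⟨R, hR⟩ := hgc.isBounded.subset_ball 0
  rw [← integral_zero (EuclideanSpace ℝ (Fin 3)) ℂ (μ := volume)]
  refine tendsto_integral_filter_of_dominated_convergence
    ((Metric.ball 0 R).indicator fun x => ‖x‖⁻¹ * C) ?_ ?_ ?_ ?_
  · exact Eventually.of_forall fun ε =>
      (by fun_prop : Measurable fun x : EuclideanSpace ℝ (Fin 3) =>
        ε / (‖x‖ ^ 2 / 2 + ε ^ 2 / 2)).aestronglyMeasurable.smul hg.aestronglyMeasurable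
  · filter_upwards [self_mem_nhdsWithin] with ε (hε : 0 < ε)
    filter_upwards [Measure.ae_ne volume 0] with x hx
    have hx : 0 < ‖x‖ := norm_pos_iff.2 hx
    by_cases hxR : x ∈ Metric.ball 0 R
    · rw [indicator_of_mem hxR, norm_smul, Real.norm_of_nonneg (by positivity)]
      gcongr
      · rw [inv_eq_one_div, div_le_div_iff₀ (by positivity) hx]
        nlinarith [sq_nonneg (‖x‖ - ε)]
      · exact hC x
    · rw [indicator_of_notMem hxR, image_eq_zero_of_notMem_tsupport fun h => hxR (hR h)]
      simp
  · exact IntegrableOn.integrable_indicator ((integrableOn_ball_inv_norm R).mul_const C)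
      measurableSet_ball
  · filter_upwards [Measure.ae_ne volume 0] with x hx
    have hx : 0 < ‖x‖ := norm_pos_iff.2 hx
    have hcont : ContinuousAt (fun ε : ℝ => (ε / (‖x‖ ^ 2 / 2 + ε ^ 2 / 2)) • g x) 0 := by
      refine ContinuousAt.smul (continuousAt_id.div (by fun_prop) (by positivity))
        continuousAt_const
    simpa using hcont.tendsto.mono_left nhdsWithin_le_nhds

/-- **Flat-space δ-function representation (Lemma 1(b) of the paper).**
For every continuous compactly supported `f : ℝ³ → ℂ` and every continuous `v : ℝ³ → ℂ`,
with `σ x = |x|²/2`,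
`lim_{ε→0⁺} −(ε/(4π²)) ∫ f(x)·(−1/(σ(x)+ε²/2)² + v(x)/(σ(x)+ε²/2)) dx = f 0`,
i.e. the family `x ↦ −(ε/(4π²))(−1/(σ(x)+ε²/2)² + v(x)/(σ(x)+ε²/2))` converges to the
Dirac delta at the origin as `ε → 0⁺`. -/
theorem delta_function_representation
    (f v : EuclideanSpace ℝ (Fin 3) → ℂ)
    (hf : Continuous f) (hfc : HasCompactSupport f) (hv : Continuous v) :
    Filter.Tendsto
      (fun ε : ℝ =>
        -((ε / (4 * Real.pi ^ 2) : ℝ) : ℂ) *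
          ∫ x : EuclideanSpace ℝ (Fin 3),
            f x * (-1 / (((‖x‖ ^ 2 / 2 + ε ^ 2 / 2 : ℝ) : ℂ) ^ 2) +
              v x / ((‖x‖ ^ 2 / 2 + ε ^ 2 / 2 : ℝ) : ℂ)))
      (nhdsWithin 0 (Set.Ioi 0)) (nhds (f 0)) := by
  have hmain := tendsto_integral_div_norm_sq_add_sq_sq (hf.integrable_of_hasCompactSupport hfc)
    hf.continuousAt
  have hrem := (tendsto_integral_smul_of_hasCompactSupport (hf.mul hv) hfc.mul_right).const_mul
    (-((4 * Real.pi ^ 2 : ℝ) : ℂ)⁻¹)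
  have hsum := hmain.add hrem
  rw [mul_zero, add_zero] at hsum
  refine hsum.congr' ?_
  filter_upwards [self_mem_nhdsWithin] with ε (hε : 0 < ε)
  have hint₁ : Integrable fun x : EuclideanSpace ℝ (Fin 3) =>
      (ε / (Real.pi ^ 2 * (‖x‖ ^ 2 + ε ^ 2) ^ 2)) • f x := by
    refine integrable_smul_of_hasCompactSupport ?_ hf hfc
    exact continuous_const.div (by fun_prop) fun x => by positivity
  have hint₂ : Integrable fun x : EuclideanSpace ℝ (Fin 3) =>
      (ε / (‖x‖ ^ 2 / 2 + ε ^ 2 / 2)) • (f x * v x) := by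
    refine integrable_smul_of_hasCompactSupport ?_ (hf.mul hv) hfc.mul_right
    exact continuous_const.div (by fun_prop) fun x => by positivity
  simp only [Pi.mul_apply]
  rw [← integral_const_mul, ← integral_const_mul]
  refine (integral_add hint₁ (hint₂.const_mul _)).symm.trans ?_
  refine integral_congr_ae (Eventually.of_forall fun x => ?_)
  have hpos : (0 : ℝ) < ‖x‖ ^ 2 + ε ^ 2 := by positivity
  have hne : ((‖x‖ : ℂ) ^ 2 + (ε : ℂ) ^ 2) ≠ 0 := by exact_mod_cast hpos.ne'
  have hpi : (Real.pi : ℂ) ≠ 0 := by exact_mod_cast Real.pi_ne_zero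
  simp only [Complex.real_smul]
  push_cast
  rw [← add_div]
  field_simp
  ring
end
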